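/- Let (T(t))_{t≥0} be a bounded C₀-semigroup on a complex Banach space X with generator A, and let C : D(A) → X be a linear map for which there exists c₀ > 0 with ‖Cx‖ ≤ c₀(‖x‖ + ‖Ax‖) for all x ∈ D(A), such that T(t)Cx = C T(t)x for all x ∈ D(A) and all t ≥ 0. Let 1 ≤ p < ∞ and assume C is L^p-infinite-time admissible for A. Then there exists M > 0 such that ‖C T(t) x‖ ≤ (M / t^{1/p}) ‖x‖ for all t > 0 and all x ∈ D(A); in particular, for each t > 0 the map x ↦ C T(t)x extends to a bounded linear operator on X of norm at most M/t^{1/p}. -/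

import Mathlib

open MeasureTheory

section SemigroupGenerator

variable {X : Type*} [NormedAddCommGroup X] [NormedSpace ℂ X]

/-- The domain of the generator of a family `T` of bounded operators, as a submodule. -/
def generatorDomain (T : ℝ → X →L[ℂ] X) : Submodule ℂ X where
  carrier := {x | ∃ y, Filter.Tendsto (fun t : ℝ => (t : ℂ)⁻¹ • (T t x - x))
    (nhdsWithin 0 (Set.Ioi 0)) (nhds y)}
  zero_mem' := ⟨0, by simp⟩
  add_mem' := by
    rintro x x' ⟨y, hy⟩ ⟨y', hy'⟩
    refine ⟨y + y', (hy.add hy').congr fun t => ?_⟩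
    rw [← smul_add, map_add]
    congr 1
    abel
  smul_mem' := by
    rintro a x ⟨y, hy⟩
    refine ⟨a • y, (hy.const_smul a).congr fun t => ?_⟩
    rw [smul_comm, smul_sub, map_smul]

theorem mem_generatorDomain {T : ℝ → X →L[ℂ] X} {x : X} :
    x ∈ generatorDomain T ↔ ∃ y, Filter.Tendsto (fun t : ℝ => (t : ℂ)⁻¹ • (T t x - x))
      (nhdsWithin 0 (Set.Ioi 0)) (nhds y) :=
  Iff.rfl

theorem map_mem_generatorDomain {T : ℝ → X →L[ℂ] X}
    (hTsemi : ∀ s t : ℝ, 0 ≤ s → 0 ≤ t → T (s + t) = T s ∘L T t)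
    {s : ℝ} (hs : 0 ≤ s) {x : X} (hx : x ∈ generatorDomain T) :
    T s x ∈ generatorDomain T := by
  obtain ⟨y, hy⟩ := hx
  refine ⟨T s y, (((T s).continuous.tendsto y).comp hy).congr' ?_⟩
  filter_upwards [self_mem_nhdsWithin] with t ht
  have h : T t (T s x) = T s (T t x) := by
    rw [← ContinuousLinearMap.comp_apply, ← ContinuousLinearMap.comp_apply,
      ← hTsemi t s (le_of_lt ht) hs, ← hTsemi s t hs (le_of_lt ht), add_comm]
  simp only [Function.comp_apply, map_smul, map_sub, h]

theorem dense_generatorDomain [CompleteSpace X] {T : ℝ → X →L[ℂ] X}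
    (hT0 : T 0 = 1)
    (hTsemi : ∀ s t : ℝ, 0 ≤ s → 0 ≤ t → T (s + t) = T s ∘L T t)
    (hTcont : ∀ x : X, ContinuousOn (fun t : ℝ => T t x) (Set.Ici 0)) :
    Dense (generatorDomain T : Set X) := by
  intro x
  set u : ℝ → X := fun s => T (max s 0) x with hu
  have hu_cont : Continuous u :=
    (hTcont x).comp_continuous (by fun_prop) fun s => le_max_right s 0
  set F : ℝ → X := fun r => ∫ s in (0 : ℝ)..r, u s with hF
  have hF_deriv : ∀ r, HasDerivAt F (u r) r := fun r =>
    intervalIntegral.integral_hasDerivAt_right (hu_cont.intervalIntegrable _ _)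
      hu_cont.stronglyMeasurable.stronglyMeasurableAtFilter hu_cont.continuousAt
  have hF0 : F 0 = 0 := intervalIntegral.integral_same
  have hu0 : u 0 = x := by simp [hu, hT0]
  have hTF : ∀ r h, 0 ≤ r → 0 ≤ h → T r (F h) = F (h + r) - F r := by
    intro r h hr hh
    rw [hF]
    simp only
    rw [← ContinuousLinearMap.intervalIntegral_comp_comm _ (hu_cont.intervalIntegrable _ _),
      intervalIntegral.integral_interval_sub_left (hu_cont.intervalIntegrable _ _)
        (hu_cont.intervalIntegrable _ _)]
    have hshift := intervalIntegral.integral_comp_add_right (a := 0) (b := h) u r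
    rw [zero_add] at hshift
    rw [← hshift]
    refine intervalIntegral.integral_congr fun s hs => ?_
    rw [Set.uIcc_of_le hh] at hs
    simp only [hu]
    rw [max_eq_left hs.1, max_eq_left (add_nonneg hs.1 hr), add_comm s r, hTsemi r s hr hs.1,
      ContinuousLinearMap.comp_apply]
  have hmem : ∀ h, 0 ≤ h → F h ∈ generatorDomain T := by
    intro h hh
    have hd : HasDerivAt (fun r => F (h + r) - F r) (u (h + 0) - u 0) 0 :=
      (HasDerivAt.comp_const_add h 0 (hF_deriv (h + 0))).sub (hF_deriv 0)
    refine ⟨_, hd.tendsto_slope_zero_right.congr' ?_⟩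
    filter_upwards [self_mem_nhdsWithin] with r hr
    rw [hTF r h (le_of_lt hr) hh, ← Complex.ofReal_inv, Complex.coe_smul]
    simp [hF0]
  refine mem_closure_of_tendsto (b := nhdsWithin (0 : ℝ) (Set.Ioi 0)) (hu0 ▸
    (hF_deriv 0).tendsto_slope_zero_right) ?_
  filter_upwards [self_mem_nhdsWithin] with r hr
  rw [hF0, sub_zero, zero_add, ← Complex.coe_smul]
  exact Submodule.smul_mem _ _ (hmem r (le_of_lt hr))

end SemigroupGenerator

/-- If `f t ≤ c * f s` for `0 < s < t` and `f` is controlled in `L^p`, then `f` decays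
like `t ^ (-1 / p)`. -/
theorem le_div_rpow_of_lintegral_rpow_le {f : ℝ → ℝ} (hf : ∀ s, 0 ≤ f s) {c K p : ℝ} (hc : 0 < c)
    (hK : 0 ≤ K) (hp : 0 < p) {t : ℝ} (ht : 0 < t) (hle : ∀ s, 0 < s → s < t → f t ≤ c * f s)
    (hint : ∫⁻ s in Set.Ioi (0 : ℝ), ENNReal.ofReal (f s ^ p) ≤ ENNReal.ofReal (K ^ p)) :
    f t ≤ c * K / t ^ (1 / p) := by
  have h1 : ENNReal.ofReal ((f t / c) ^ p * t) ≤ ENNReal.ofReal (K ^ p) := by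
    calc ENNReal.ofReal ((f t / c) ^ p * t)
        = ∫⁻ _ in Set.Ioo (0 : ℝ) t, ENNReal.ofReal ((f t / c) ^ p) := by
          rw [setLIntegral_const, Real.volume_Ioo, sub_zero,
            ENNReal.ofReal_mul (Real.rpow_nonneg (div_nonneg (hf t) hc.le) p)]
      _ ≤ ∫⁻ s in Set.Ioo (0 : ℝ) t, ENNReal.ofReal (f s ^ p) := by
          refine setLIntegral_mono' measurableSet_Ioo fun s hs => ENNReal.ofReal_le_ofReal ?_
          exact Real.rpow_le_rpow (div_nonneg (hf t) hc.le)
            ((div_le_iff₀' hc).2 (hle s hs.1 hs.2)) hp.le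
      _ ≤ ∫⁻ s in Set.Ioi (0 : ℝ), ENNReal.ofReal (f s ^ p) :=
          lintegral_mono_set Set.Ioo_subset_Ioi_self
      _ ≤ _ := hint
  rw [ENNReal.ofReal_le_ofReal_iff (Real.rpow_nonneg hK p)] at h1
  have htp : 0 < t ^ (1 / p) := Real.rpow_pos_of_pos ht _
  have h2 : (f t / c * t ^ (1 / p)) ^ p ≤ K ^ p := by
    rwa [Real.mul_rpow (div_nonneg (hf t) hc.le) htp.le, ← Real.rpow_mul ht.le,
      one_div_mul_cancel hp.ne', Real.rpow_one]
  have h3 := (Real.rpow_le_rpow_iff (mul_nonneg (div_nonneg (hf t) hc.le) htp.le) hK hp).1 h2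
  rw [le_div_iff₀ htp]
  calc f t * t ^ (1 / p) = c * (f t / c * t ^ (1 / p)) := by field_simp
    _ ≤ c * K := by gcongr

/-- If `C` (relatively `A`-bounded, commuting with the semigroup) is
`L^p`-infinite-time admissible for the generator `A` of a bounded C₀-semigroup on a
Banach space, then `‖C T(t)x‖ ≤ (M/t^(1/p))‖x‖` for all `t > 0` and `x ∈ D(A)`; in
particular each `C T(t)` extends to a bounded operator of norm at most `M/t^(1/p)`. -/
theorem stmt_7
    {X : Type*} [NormedAddCommGroup X] [NormedSpace ℂ X] [CompleteSpace X]
    (T : ℝ → X →L[ℂ] X)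
    (hT0 : T 0 = 1)
    (hTsemi : ∀ s t : ℝ, 0 ≤ s → 0 ≤ t → T (s + t) = T s ∘L T t)
    (hTcont : ∀ x : X, ContinuousOn (fun t : ℝ => T t x) (Set.Ici 0))
    (hTbdd : ∃ c : ℝ, ∀ t : ℝ, 0 ≤ t → ‖T t‖ ≤ c)
    (Dom : Set X) (A : X → X)
    (hgen : ∀ x y, (x ∈ Dom ∧ A x = y) ↔
      Filter.Tendsto (fun t : ℝ => (t : ℂ)⁻¹ • (T t x - x))
        (nhdsWithin 0 (Set.Ioi 0)) (nhds y))
    (C : X → X)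
    (hCadd : ∀ x ∈ Dom, ∀ y ∈ Dom, C (x + y) = C x + C y)
    (hCsmul : ∀ (a : ℂ), ∀ x ∈ Dom, C (a • x) = a • C x)
    (hCbdd : ∃ c₀ > 0, ∀ x ∈ Dom, ‖C x‖ ≤ c₀ * (‖x‖ + ‖A x‖))
    (hcomm : ∀ t : ℝ, 0 ≤ t → ∀ x ∈ Dom, T t (C x) = C (T t x))
    (p : ℝ) (hp : 1 ≤ p)
    (hadm : ∃ M₀ > 0, ∀ x ∈ Dom,
      ∫⁻ t in Set.Ioi (0 : ℝ), ENNReal.ofReal (‖C (T t x)‖ ^ p)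
        ≤ ENNReal.ofReal (M₀ * ‖x‖ ^ p)) :
    ∃ M > 0,
      (∀ t : ℝ, 0 < t → ∀ x ∈ Dom, ‖C (T t x)‖ ≤ M / t ^ (1 / p) * ‖x‖) ∧
      (∀ t : ℝ, 0 < t → ∃ S : X →L[ℂ] X,
        ‖S‖ ≤ M / t ^ (1 / p) ∧ ∀ x ∈ Dom, S x = C (T t x)) := by
  obtain ⟨c, hc⟩ := hTbdd
  obtain ⟨M₀, hM₀, hadm⟩ := hadm
  have hp0 : 0 < p := one_pos.trans_le hp
  have hDom : ∀ x, x ∈ Dom ↔ x ∈ generatorDomain T := fun x =>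
    ⟨fun hx => ⟨A x, (hgen x (A x)).1 ⟨hx, rfl⟩⟩, fun ⟨y, hy⟩ => ((hgen x y).2 hy).1⟩
  have hTDom : ∀ t, 0 ≤ t → ∀ x ∈ Dom, T t x ∈ Dom := fun t ht x hx =>
    (hDom _).2 (map_mem_generatorDomain hTsemi ht ((hDom x).1 hx))
  have hc0 : 0 < max c 1 := lt_max_of_lt_right one_pos
  have hM₀p : 0 < M₀ ^ (1 / p) := Real.rpow_pos_of_pos hM₀ _
  have hdecay : ∀ t : ℝ, 0 < t → ∀ x ∈ Dom,
      ‖C (T t x)‖ ≤ max c 1 * M₀ ^ (1 / p) / t ^ (1 / p) * ‖x‖ := by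
    intro t ht x hx
    have h := le_div_rpow_of_lintegral_rpow_le (f := fun s => ‖C (T s x)‖)
      (K := M₀ ^ (1 / p) * ‖x‖) (fun s => norm_nonneg _) hc0 (by positivity) hp0 ht ?_ ?_
    · exact h.trans_eq (by ring)
    · intro s hs hst
      have hcs : C (T t x) = T (t - s) (C (T s x)) := by
        rw [hcomm _ (sub_nonneg.2 hst.le) _ (hTDom s hs.le x hx), ← ContinuousLinearMap.comp_apply,
          ← hTsemi _ _ (sub_nonneg.2 hst.le) hs.le, sub_add_cancel]
      simp only [hcs]
      exact (T (t - s)).le_of_opNorm_le ((hc _ (sub_nonneg.2 hst.le)).trans (le_max_left _ _)) _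
    · rw [Real.mul_rpow hM₀p.le (norm_nonneg x), ← Real.rpow_mul hM₀.le,
        one_div_mul_cancel hp0.ne', Real.rpow_one]
      exact hadm x hx
  refine ⟨max c 1 * M₀ ^ (1 / p), by positivity, hdecay, fun t ht => ?_⟩
  let L : generatorDomain T →ₗ[ℂ] X :=
    { toFun := fun x => C (T t x)
      map_add' := fun x y => by
        rw [Submodule.coe_add, map_add]
        exact hCadd _ (hTDom t ht.le _ ((hDom _).2 x.2)) _ (hTDom t ht.le _ ((hDom _).2 y.2))
      map_smul' := fun a x => by
        rw [Submodule.coe_smul, map_smul]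
        exact hCsmul a _ (hTDom t ht.le _ ((hDom _).2 x.2)) }
  have hL : ∀ x : generatorDomain T, ‖L x‖ ≤
      max c 1 * M₀ ^ (1 / p) / t ^ (1 / p) * ‖(generatorDomain T).subtype x‖ := fun x =>
    hdecay t ht x ((hDom _).2 x.2)
  have hdense : DenseRange (generatorDomain T).subtype :=
    (dense_generatorDomain hT0 hTsemi hTcont).denseRange_val
  exact ⟨L.extendOfNorm (generatorDomain T).subtype,
    LinearMap.opNorm_extendOfNorm_le hdense (by positivity) hL,
    fun x hx => LinearMap.extendOfNorm_eq hdense ⟨_, hL⟩ ⟨x, (hDom x).1 hx⟩⟩
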